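/- arXiv:2504.15935 — 6 statements merged into one kernel-verified Lean document; each statement's English description precedes it below -/
import Mathlib

section
/- Let α ∈ (0,2π) and let d ∈ ℤ satisfy d ≤ 0, and assume α > 2π/3. Then the set { (2π/α)·(d₀ − 1 + α/(2π))² + |d − d₀| : d₀ ∈ ℤ } has a least element, and this least element equals |d| + (α − 2π)²/(2πα); moreover the minimum is attained at d₀ = 0. -/
open Real

lemma div_mul_sub_one_add_div_sq {p a : ℝ} (hp : p ≠ 0) (ha : a ≠ 0) (x : ℝ) :
    (p / a) * (x - 1 + a / p) ^ 2 =
      (a - p) ^ 2 / (p * a) + x * (p * (x - 2) + 2 * a) / a := by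
  field_simp
  ring

/-- For an integer `n`, the factors `n` and `p (n - 2) + 3 a` have the same sign as soon as
`p ≤ 3 a ≤ 3 p`. -/
lemma int_mul_nonneg_of_le_three_mul {p a : ℝ} (hp : 0 ≤ p) (hap : a ≤ p) (hpa : p ≤ 3 * a)
    (n : ℤ) : 0 ≤ (n : ℝ) * (p * (n - 2) + 3 * a) := by
  rcases lt_trichotomy n 0 with hn | rfl | hn
  · have h : (n : ℝ) ≤ -1 := by exact_mod_cast Int.le_sub_one_of_lt hn
    exact mul_nonneg_of_nonpos_of_nonpos (by linarith) (by nlinarith)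
  · simp
  · have h : (1 : ℝ) ≤ n := by exact_mod_cast hn
    exact mul_nonneg (by linarith) (by nlinarith)

/-- For `α ∈ (0, 2π)` with `α > 2π/3` and `d ≤ 0`, the set of values
`(2π/α)(d₀ − 1 + α/(2π))² + |d − d₀|` over `d₀ ∈ ℤ` has least element
`|d| + (α − 2π)²/(2πα)`, attained at `d₀ = 0`. -/
theorem stmt_0 (α : ℝ) (hα : α ∈ Set.Ioo 0 (2 * π)) (d : ℤ) (hd : d ≤ 0)
    (hα3 : α > 2 * π / 3) :
    IsLeast
      {x : ℝ | ∃ d₀ : ℤ,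
        x = (2 * π / α) * ((d₀ : ℝ) - 1 + α / (2 * π)) ^ 2 + |(d : ℝ) - (d₀ : ℝ)|}
      (|(d : ℝ)| + (α - 2 * π) ^ 2 / (2 * π * α)) ∧
    (2 * π / α) * (((0 : ℤ) : ℝ) - 1 + α / (2 * π)) ^ 2 + |(d : ℝ) - ((0 : ℤ) : ℝ)|
      = |(d : ℝ)| + (α - 2 * π) ^ 2 / (2 * π * α) := by
  obtain ⟨h0, h1⟩ := hα
  have hp : 0 < 2 * π := two_pi_pos
  have hzero : (2 * π / α) * (((0 : ℤ) : ℝ) - 1 + α / (2 * π)) ^ 2 + |(d : ℝ) - ((0 : ℤ) : ℝ)|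
      = |(d : ℝ)| + (α - 2 * π) ^ 2 / (2 * π * α) := by
    rw [div_mul_sub_one_add_div_sq hp.ne' h0.ne']
    simp [add_comm]
  refine ⟨⟨⟨0, hzero.symm⟩, ?_⟩, hzero⟩
  rintro _ ⟨n, rfl⟩
  rw [div_mul_sub_one_add_div_sq hp.ne' h0.ne', abs_of_nonpos (by exact_mod_cast hd)]
  have habs : (n : ℝ) - d ≤ |(d : ℝ) - n| := by
    rw [abs_sub_comm]
    exact le_abs_self _
  have hn : 0 ≤ (n : ℝ) * (2 * π * (n - 2) + 3 * α) / α :=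
    div_nonneg (int_mul_nonneg_of_le_three_mul hp.le h1.le (by linarith) n) h0.le
  have hsplit : (n : ℝ) * (2 * π * (n - 2) + 3 * α) / α =
      n * (2 * π * (n - 2) + 2 * α) / α + n := by
    field_simp
    ring
  linarith
end

section
/- Let α ∈ (0,2π) and d ∈ ℤ, and assume that d ≥ 1 or α ≤ 2π/3. Then the set { (2π/α)·(d₀ − 1 + α/(2π))² + |d − d₀| : d₀ ∈ ℤ } has a least element, and this least element equals |d − 1| + α/(2π); moreover the minimum is attained at d₀ = 1. -/
open Real

/-- An integer satisfies `|k| ≤ k ^ 2` as a real number. -/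
theorem abs_intCast_le_sq (k : ℤ) : |(k : ℝ)| ≤ (k : ℝ) ^ 2 := by
  rw [← sq_abs]
  exact_mod_cast Int.le_self_sq |k|

theorem abs_le_sq_div_add_two_mul_add_abs_sub {t : ℝ} (ht : 0 < t) (ht1 : t < 1) (e k : ℤ)
    (h : 0 ≤ e ∨ t ≤ 1 / 3) :
    |(e : ℝ)| ≤ (k : ℝ) ^ 2 / t + 2 * k + |(e : ℝ) - k| := by
  have hk := abs_intCast_le_sq k
  have hk0 := abs_nonneg (k : ℝ)
  rcases h with he | ht3
  · have he' : (0 : ℝ) ≤ e := by exact_mod_cast he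
    have hq : |(k : ℝ)| ≤ (k : ℝ) ^ 2 / t := by
      rw [le_div_iff₀ ht]
      nlinarith
    have hek := le_abs_self ((e : ℝ) - k)
    have hneg := neg_abs_le (k : ℝ)
    rw [abs_of_nonneg he']
    linarith
  · have hq : 3 * |(k : ℝ)| ≤ (k : ℝ) ^ 2 / t := by
      rw [le_div_iff₀ ht]
      nlinarith
    have hek := abs_sub_abs_le_abs_sub (e : ℝ) k
    have hneg := neg_abs_le (k : ℝ)
    linarith

/-- For `α ∈ (0, 2π)` and `d ∈ ℤ` with `d ≥ 1` or `α ≤ 2π/3`, the set of values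
`(2π/α)(d₀ − 1 + α/(2π))² + |d − d₀|` over `d₀ ∈ ℤ` has least element
`|d − 1| + α/(2π)`, attained at `d₀ = 1`. -/
theorem stmt_1 (α : ℝ) (hα : α ∈ Set.Ioo 0 (2 * π)) (d : ℤ)
    (hcase : 1 ≤ d ∨ α ≤ 2 * π / 3) :
    IsLeast
      {x : ℝ | ∃ d₀ : ℤ,
        x = (2 * π / α) * ((d₀ : ℝ) - 1 + α / (2 * π)) ^ 2 + |(d : ℝ) - (d₀ : ℝ)|}
      (|(d : ℝ) - 1| + α / (2 * π)) ∧
    (2 * π / α) * (((1 : ℤ) : ℝ) - 1 + α / (2 * π)) ^ 2 + |(d : ℝ) - ((1 : ℤ) : ℝ)|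
      = |(d : ℝ) - 1| + α / (2 * π) := by
  obtain ⟨hα0, hα2⟩ := hα
  have hπ : 0 < 2 * π := two_pi_pos
  have hvalue : (2 * π / α) * (((1 : ℤ) : ℝ) - 1 + α / (2 * π)) ^ 2 + |(d : ℝ) - ((1 : ℤ) : ℝ)|
      = |(d : ℝ) - 1| + α / (2 * π) := by
    push_cast
    field_simp
    ring
  refine ⟨⟨⟨1, hvalue.symm⟩, ?_⟩, hvalue⟩
  rintro x ⟨d₀, rfl⟩
  have hcase' : 0 ≤ d - 1 ∨ α / (2 * π) ≤ 1 / 3 := by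
    refine hcase.imp (fun h => by lia) (fun h => ?_)
    rw [div_le_iff₀ hπ]
    linarith
  have key := abs_le_sq_div_add_two_mul_add_abs_sub (div_pos hα0 hπ) ((div_lt_one hπ).2 hα2)
    (d - 1) (d₀ - 1) hcase'
  push_cast at key
  rw [sub_sub_sub_cancel_right] at key
  have hexpand : (2 * π / α) * ((d₀ : ℝ) - 1 + α / (2 * π)) ^ 2
      = ((d₀ : ℝ) - 1) ^ 2 / (α / (2 * π)) + 2 * ((d₀ : ℝ) - 1) + α / (2 * π) := by
    field_simp
    ring
  linarith
end

section
/- Let α ∈ (0,2π), let d̄ ∈ ℤ, let n ∈ ℕ, and let d₀, d₁, …, dₙ ∈ ℤ satisfy Σ_{j=0}^{n} d_j = d̄. Then m(d̄,α) ≤ m(d₀,α) + Σ_{j=1}^{n} |d_j|. -/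
open Real

/-- The minimal vortex-energy coefficient `m(d, α)` from the paper:
`m(d,α) = |d| + (α − 2π)²/(2πα)` if `d ≤ 0` and `α > 2π/3`,
and `m(d,α) = |d − 1| + α/(2π)` otherwise. -/
noncomputable def mCoeff (d : ℤ) (α : ℝ) : ℝ :=
  if d ≤ 0 ∧ α > 2 * π / 3 then
    |(d : ℝ)| + (α - 2 * π) ^ 2 / (2 * π * α)
  else
    |(d : ℝ) - 1| + α / (2 * π)

/-- `mCoeff · α` is `1`-Lipschitz in the degree. -/
theorem mCoeff_le_add_abs_sub {α : ℝ} (hα : α ∈ Set.Ioo 0 (2 * π)) (a b : ℤ) :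
    mCoeff a α ≤ mCoeff b α + |(a : ℝ) - b| := by
  obtain ⟨h0, h1⟩ := hα
  have hpi := Real.pi_pos
  have hA : 0 ≤ (α - 2 * π) ^ 2 / (2 * π * α) := by positivity
  have ht : α / (2 * π) < 1 := (div_lt_one (by positivity)).2 h1
  have habs : |(a : ℝ)| ≤ |(b : ℝ)| + |(a : ℝ) - b| := by
    simpa using abs_add_le (b : ℝ) (a - b)
  have habs_one : |(a : ℝ) - 1| ≤ |(b : ℝ) - 1| + |(a : ℝ) - b| := by
    simpa using abs_add_le ((b : ℝ) - 1) (a - b)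
  unfold mCoeff
  by_cases hc : α > 2 * π / 3
  · have hB : (α - 2 * π) ^ 2 / (2 * π * α) ≤ 1 + α / (2 * π) := by
      rw [show 1 + α / (2 * π) = (2 * π * α + α ^ 2) / (2 * π * α) by field_simp]
      gcongr
      nlinarith
    simp only [hc, and_true]
    split_ifs with ha hb hb
    · linarith
    · have ha' : (a : ℝ) ≤ 0 := by exact_mod_cast ha
      have hb' : (1 : ℝ) ≤ b := by exact_mod_cast not_le.1 hb
      rw [abs_of_nonpos ha', abs_of_nonneg (sub_nonneg.2 hb'), abs_of_nonpos (by linarith)]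
      linarith
    · have ha' : (1 : ℝ) ≤ a := by exact_mod_cast not_le.1 ha
      have hb' : (b : ℝ) ≤ 0 := by exact_mod_cast hb
      rw [abs_of_nonpos hb', abs_of_nonneg (sub_nonneg.2 ha'), abs_of_nonneg (by linarith)]
      linarith
    · linarith
  · simp only [hc, and_false, if_false]
    linarith

/-- Subadditivity of `m`: if `d₀ + d₁ + ⋯ + dₙ = d̄`, then
`m(d̄,α) ≤ m(d₀,α) + Σ_{j=1}^{n} |d_j|`. -/
theorem stmt_3 (α : ℝ) (hα : α ∈ Set.Ioo 0 (2 * π)) (dbar : ℤ) (n : ℕ)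
    (d : ℕ → ℤ) (hsum : ∑ j ∈ Finset.range (n + 1), d j = dbar) :
    mCoeff dbar α ≤ mCoeff (d 0) α + ∑ j ∈ Finset.Icc 1 n, |((d j : ℝ))| := by
  have hsplit : (dbar : ℝ) - d 0 = ∑ j ∈ Finset.Icc 1 n, (d j : ℝ) := by
    rw [← hsum, Finset.range_eq_Ico, Finset.sum_eq_sum_Ico_succ_bot n.succ_pos]
    push_cast
    rw [add_sub_cancel_left]
    rfl
  calc mCoeff dbar α ≤ mCoeff (d 0) α + |(dbar : ℝ) - d 0| := mCoeff_le_add_abs_sub hα _ _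
    _ ≤ _ := by
      rw [hsplit]
      gcongr
      exact Finset.abs_sum_le_sum_abs _ _
end

section
/- Let α ∈ (0,2π), let d̄ ∈ ℤ, let K ∈ ℕ, and let d₀, d₁, …, d_K ∈ ℤ satisfy Σ_{j=0}^{K} d_j = d̄. Then (2π/α)·(d₀ − 1 + α/(2π))² + Σ_{j=1}^{K} d_j² ≥ m(d̄,α). -/
open Real

theorem abs_sub_le_sum_sq (d : ℕ → ℤ) (K : ℕ) :
    |((∑ j ∈ Finset.range (K + 1), d j : ℤ) : ℝ) - (d 0 : ℝ)|
      ≤ ∑ j ∈ Finset.Icc 1 K, (d j : ℝ) ^ 2 := by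
  have hI : Finset.Icc 1 K = Finset.Ico 1 (K + 1) := by
    ext j
    simp only [Finset.mem_Icc, Finset.mem_Ico]
    omega
  have h : ((∑ j ∈ Finset.range (K + 1), d j : ℤ) : ℝ) - (d 0 : ℝ)
      = ∑ j ∈ Finset.Icc 1 K, (d j : ℝ) := by
    rw [Finset.range_eq_Ico, Finset.sum_eq_sum_Ico_succ_bot (Nat.succ_pos K), hI]
    push_cast
    ring
  rw [h]
  refine (Finset.abs_sum_le_sum_abs _ _).trans (Finset.sum_le_sum fun j _ => ?_)
  have hj : |d j| ≤ d j ^ 2 := by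
    rw [← sq_abs, ← Int.natCast_natAbs]
    exact_mod_cast Nat.le_self_pow two_ne_zero _
  exact_mod_cast hj

theorem int_mul_succ_nonneg (k : ℤ) : (0 : ℝ) ≤ (k : ℝ) * (k + 1) := by
  have h : 0 ≤ k * (k + 1) := by
    rcases le_or_gt 0 k with hk | hk
    · positivity
    · exact mul_nonneg_of_nonpos_of_nonpos hk.le (by omega)
  exact_mod_cast h

/-- For `1 ≤ x ≤ 3`, the quadratic `(k + 1) * (x * (k - 1) + 3)` is nonnegative at integers. -/
theorem int_succ_mul_nonneg (k : ℤ) (x : ℝ) (h1 : 1 ≤ x) (h3 : x ≤ 3) :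
    0 ≤ ((k : ℝ) + 1) * (x * (k - 1) + 3) := by
  rcases lt_trichotomy k (-1) with hk | rfl | hk
  · have hk' : (k : ℝ) ≤ -2 := by exact_mod_cast (by omega : k ≤ -2)
    exact mul_nonneg_of_nonpos_of_nonpos (by linarith) (by nlinarith)
  · norm_num
  · have hk' : (0 : ℝ) ≤ k := by exact_mod_cast (by omega : 0 ≤ k)
    exact mul_nonneg (by linarith) (by nlinarith)

/-- If `d₀ + d₁ + ⋯ + d_K = d̄`, then
`(2π/α)(d₀ − 1 + α/(2π))² + Σ_{j=1}^{K} d_j² ≥ m(d̄, α)`. -/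
theorem stmt_4 (α : ℝ) (hα : α ∈ Set.Ioo 0 (2 * π)) (dbar : ℤ) (K : ℕ)
    (d : ℕ → ℤ) (hsum : ∑ j ∈ Finset.range (K + 1), d j = dbar) :
    (2 * π / α) * ((d 0 : ℝ) - 1 + α / (2 * π)) ^ 2
        + ∑ j ∈ Finset.Icc 1 K, ((d j : ℝ)) ^ 2
      ≥ mCoeff dbar α := by
  obtain ⟨h0, h1⟩ := hα
  have hπ := Real.pi_pos
  have hS := abs_sub_le_sum_sq d K
  rw [hsum] at hS
  set S := ∑ j ∈ Finset.Icc 1 K, (d j : ℝ) ^ 2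
  obtain ⟨k, hk⟩ : ∃ k : ℤ, d 0 = k + 1 := ⟨d 0 - 1, by ring⟩
  set x := 2 * π / α with hx
  have hx1 : 1 ≤ x := by rw [hx, le_div_iff₀ h0]; linarith
  have hE : x * ((d 0 : ℝ) - 1 + α / (2 * π)) ^ 2 = x * k ^ 2 + 2 * k + α / (2 * π) := by
    rw [hk, hx]
    push_cast
    field_simp
    ring
  rw [hE]
  rw [hk] at hS
  push_cast at hS
  have hk0 := int_mul_succ_nonneg k
  have hkx : (k : ℝ) ^ 2 ≤ x * k ^ 2 := le_mul_of_one_le_left (sq_nonneg _) hx1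
  obtain ⟨hS1, hS2⟩ := abs_le.mp hS
  unfold mCoeff
  split_ifs with hc
  · obtain ⟨hd, hα3⟩ := hc
    have hd' : (dbar : ℝ) ≤ 0 := by exact_mod_cast hd
    have hx3 : x ≤ 3 := by rw [hx, div_le_iff₀ h0]; linarith
    have hm : (α - 2 * π) ^ 2 / (2 * π * α) = x - 2 + α / (2 * π) := by
      rw [hx]
      field_simp
      ring
    rw [hm, abs_of_nonpos hd']
    nlinarith [int_succ_mul_nonneg k x hx1 hx3]
  · rcases le_or_gt dbar 0 with hd | hd
    · have hd' : (dbar : ℝ) ≤ 0 := by exact_mod_cast hd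
      have hα3 : α ≤ 2 * π / 3 := not_lt.mp fun h => hc ⟨hd, h⟩
      have hx3 : 3 ≤ x := by rw [hx, le_div_iff₀ h0]; linarith
      rw [abs_of_nonpos (by linarith)]
      nlinarith [mul_le_mul_of_nonneg_right hx3 (sq_nonneg (k : ℝ))]
    · have hd' : (1 : ℝ) ≤ dbar := by exact_mod_cast hd
      rw [abs_of_nonneg (by linarith)]
      nlinarith
end

section
/- Let α ∈ (0,2π) and d̄ ∈ ℤ. Define d₀ := 0 if d̄ ≤ 0 and α > 2π/3, and d₀ := 1 otherwise; set K := |d̄ − d₀| and, for 1 ≤ j ≤ K, set d_j := sign(d̄ − d₀) (so each d_j ∈ {−1, 1}). Then K ≤ |d̄| + 1, d₀ + Σ_{j=1}^{K} d_j = d̄, and (2π/α)·(d₀ − 1 + α/(2π))² + Σ_{j=1}^{K} d_j² = m(d̄,α); in particular this configuration of degrees attains the minimum of (2π/α)·(d₀ − 1 + α/(2π))² + Σ_{j=1}^{K} d_j² over all finite integer tuples (d₀, d₁, …, d_K) whose entries sum to d̄. -/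
open Real

theorem int_abs_le_sq (n : ℤ) : |n| ≤ n ^ 2 := by
  rw [Int.abs_eq_natAbs]
  exact Int.natAbs_le_self_sq n

/-- The tip energy `(2π/α)(n − 1 + α/(2π))²`, expanded. -/
theorem tip_energy_eq {α : ℝ} (hα : 0 < α) (x : ℝ) :
    (2 * π / α) * (x - 1 + α / (2 * π)) ^ 2
      = (x - 1) ^ 2 * (2 * π / α) + 2 * (x - 1) + α / (2 * π) := by
  have := Real.pi_pos
  field_simp
  ring

theorem mCoeff_eq {α : ℝ} (hα : 0 < α) (d : ℤ) :
    mCoeff d α = if d ≤ 0 ∧ α > 2 * π / 3 then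
      |(d : ℝ)| + (2 * π / α - 2 + α / (2 * π)) else |(d : ℝ) - 1| + α / (2 * π) := by
  have := Real.pi_pos
  have h : (α - 2 * π) ^ 2 / (2 * π * α) = 2 * π / α - 2 + α / (2 * π) := by
    field_simp
    ring
  rw [mCoeff, h]

/-- Among configurations whose tip has degree `n`, the energy `tip + |d − n|` is at least
`mCoeff d α`. -/
theorem mCoeff_le {α : ℝ} (hα : 0 < α) (hα' : α < 2 * π) (d n : ℤ) :
    mCoeff d α ≤ (2 * π / α) * ((n : ℝ) - 1 + α / (2 * π)) ^ 2 + |((d - n : ℤ) : ℝ)| := by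
  have hc : 1 < 2 * π / α := by rwa [one_lt_div hα]
  have hc3 : α > 2 * π / 3 ↔ 2 * π / α < 3 := by
    rw [div_lt_iff₀ hα, gt_iff_lt, div_lt_iff₀ (by norm_num), mul_comm α]
  rw [tip_energy_eq hα, mCoeff_eq hα]
  simp only [hc3]
  generalize 2 * π / α = c at hc
  generalize α / (2 * π) = t
  push_cast
  rcases le_or_gt 1 n with hn | hn
  · have hn' : (1 : ℝ) ≤ n := by exact_mod_cast hn
    have h1 : |(d : ℝ) - 1| ≤ |(d : ℝ) - n| + (n - 1) := by
      have := abs_add_le ((d : ℝ) - n) (n - 1)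
      rwa [abs_of_nonneg (sub_nonneg.2 hn'), sub_add_sub_cancel] at this
    have h2 : 0 ≤ ((n : ℝ) - 1) ^ 2 * c := by positivity
    split_ifs with h
    · have hd : (d : ℝ) ≤ 0 := by exact_mod_cast h.1
      rw [abs_of_nonpos (by linarith)] at h1
      rw [abs_of_nonpos hd]
      linarith [h.2]
    · linarith
  · have hn' : (n : ℝ) ≤ 0 := by exact_mod_cast Int.lt_add_one_iff.1 hn
    have hsq : |(n : ℝ)| ≤ (n : ℝ) ^ 2 := by exact_mod_cast int_abs_le_sq n
    have h1 : |(d : ℝ)| ≤ |(d : ℝ) - n| + |(n : ℝ)| := by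
      simpa using abs_add_le ((d : ℝ) - n) n
    have h2 : 0 ≤ (((n : ℝ) - 1) ^ 2 - 1) * (c - 1) :=
      mul_nonneg (by nlinarith) (by linarith)
    have h3 : |(d : ℝ)| + (c - 2 + t) ≤
        ((n : ℝ) - 1) ^ 2 * c + 2 * (n - 1) + t + |(d : ℝ) - n| := by
      nlinarith
    split_ifs with h
    · exact h3
    · refine le_trans ?_ h3
      rcases le_or_gt d 0 with hd | hd
      · have hd' : (d : ℝ) ≤ 0 := by exact_mod_cast hd
        have : 3 ≤ c := not_lt.1 fun hlt => h ⟨hd, hlt⟩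
        rw [abs_of_nonpos hd', abs_of_nonpos (by linarith)]
        linarith
      · have hd' : (1 : ℝ) ≤ d := by exact_mod_cast hd
        rw [abs_of_nonneg (by linarith : (0 : ℝ) ≤ d), abs_of_nonneg (by linarith)]
        linarith

/-- The absolute value of a sum of integers is at most the sum of their squares. -/
theorem abs_sum_le_sum_sq {ι : Type*} (s : Finset ι) (e : ι → ℤ) :
    |∑ j ∈ s, e j| ≤ ∑ j ∈ s, e j ^ 2 :=
  (Finset.abs_sum_le_sum_abs _ _).trans (Finset.sum_le_sum fun j _ => int_abs_le_sq (e j))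

/-- The optimal distribution of vortex degrees: the tip carries degree
`d₀ = 0` when `d̄ ≤ 0` and `α > 2π/3`, and `d₀ = 1` otherwise; the remaining
`K = |d̄ − d₀|` vortices each carry degree `sign (d̄ − d₀)`.  This configuration
sums to `d̄`, satisfies `K ≤ |d̄| + 1`, achieves energy coefficient `m(d̄, α)`,
and minimizes `(2π/α)(d₀ − 1 + α/(2π))² + Σ_{j=1}^{K} d_j²` among all finite
integer tuples summing to `d̄`. -/
theorem stmt_5 (α : ℝ) (hα : α ∈ Set.Ioo 0 (2 * π)) (dbar : ℤ)
    (d₀ : ℤ) (hd₀ : d₀ = if dbar ≤ 0 ∧ α > 2 * π / 3 then 0 else 1)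
    (K : ℕ) (hK : (K : ℤ) = |dbar - d₀|)
    (d : ℕ → ℤ) (hd : d 0 = d₀) (hdj : ∀ j, 1 ≤ j → d j = (dbar - d₀).sign) :
    (K : ℤ) ≤ |dbar| + 1 ∧
    d₀ + ∑ j ∈ Finset.Icc 1 K, d j = dbar ∧
    (2 * π / α) * ((d₀ : ℝ) - 1 + α / (2 * π)) ^ 2
        + ∑ j ∈ Finset.Icc 1 K, ((d j : ℝ)) ^ 2 = mCoeff dbar α ∧
    ∀ (K' : ℕ) (e : ℕ → ℤ), ∑ j ∈ Finset.range (K' + 1), e j = dbar →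
      (2 * π / α) * ((d₀ : ℝ) - 1 + α / (2 * π)) ^ 2
          + ∑ j ∈ Finset.Icc 1 K, ((d j : ℝ)) ^ 2
        ≤ (2 * π / α) * ((e 0 : ℝ) - 1 + α / (2 * π)) ^ 2
            + ∑ j ∈ Finset.Icc 1 K', ((e j : ℝ)) ^ 2 := by
  obtain ⟨hα0, hα1⟩ := hα
  have hsum : ∑ j ∈ Finset.Icc 1 K, d j = dbar - d₀ := by
    rw [Finset.sum_congr rfl fun j hj => hdj j (Finset.mem_Icc.1 hj).1]
    simp [hK, mul_comm |dbar - d₀|, Int.sign_mul_abs]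
  have hsq : ∑ j ∈ Finset.Icc 1 K, (d j : ℝ) ^ 2 = |((dbar - d₀ : ℤ) : ℝ)| := by
    have h : ∑ j ∈ Finset.Icc 1 K, d j ^ 2 = |dbar - d₀| := by
      rw [Finset.sum_congr rfl fun j hj => by rw [hdj j (Finset.mem_Icc.1 hj).1]]
      rcases eq_or_ne (dbar - d₀) 0 with h0 | h0
      · simp [h0]
      · rw [← sq_abs, Int.abs_sign_of_ne_zero h0]
        simp [hK]
    exact_mod_cast h
  have hval : (2 * π / α) * ((d₀ : ℝ) - 1 + α / (2 * π)) ^ 2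
      + ∑ j ∈ Finset.Icc 1 K, ((d j : ℝ)) ^ 2 = mCoeff dbar α := by
    rw [hsq, tip_energy_eq hα0, mCoeff_eq hα0, hd₀]
    split_ifs <;> push_cast <;> ring_nf
  refine ⟨?_, by rw [hsum]; ring, hval, fun K' e he => ?_⟩
  · rw [hK, hd₀]
    split_ifs
    · simp
    · simpa using abs_sub dbar 1
  · have hrest : ∑ j ∈ Finset.Icc 1 K', e j = dbar - e 0 := by
      rw [Finset.range_eq_Ico, Finset.sum_eq_sum_Ico_succ_bot (Nat.succ_pos K')] at he
      exact eq_sub_of_add_eq' he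
    have h : |((dbar - e 0 : ℤ) : ℝ)| ≤ ∑ j ∈ Finset.Icc 1 K', (e j : ℝ) ^ 2 := by
      rw [← hrest]
      exact_mod_cast abs_sum_le_sum_sq (Finset.Icc 1 K') e
    rw [hval]
    exact (mCoeff_le hα0 hα1 dbar (e 0)).trans (by gcongr)
end

section
/- Let α ∈ (0,2π), let p = (r_p, θ_p) with r_p > 0, and let ρ ∈ (0, r_p) (so the closed ball B̄(p,ρ) does not contain the tip). Suppose B̄(p,ρ) intersects every ray, i.e., for every θ₀ ∈ ℝ there exists t > 0 with d_α((t,θ₀), p) ≤ ρ. Then every point (r,θ) with d_α((r,θ), p) ≤ ρ satisfies r ≤ (1 + 2π/α)ρ. -/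
open Real

/-- Angular distance modulo `α`: `δ = min_{k ∈ ℤ} |θ − θ′ + kα|`. -/
noncomputable def angDist (α θ θ' : ℝ) : ℝ :=
  sInf (Set.range fun k : ℤ => |θ - θ' + (k : ℝ) * α|)

/-- Geodesic distance on the punctured cone of opening angle `α`, where a point is
represented by polar coordinates `(r, θ)` with `r > 0`:
`d_α((r,θ),(r′,θ′)) = √(r² + r′² − 2 r r′ cos δ)` with `δ` the angular distance mod `α`. -/
noncomputable def coneDist (α : ℝ) (p q : ℝ × ℝ) : ℝ :=
  Real.sqrt (p.1 ^ 2 + q.1 ^ 2 - 2 * p.1 * q.1 * Real.cos (angDist α p.2 q.2))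

theorem angDist_add_half {α : ℝ} (hα : 0 < α) (θ : ℝ) : angDist α (θ + α / 2) θ = α / 2 := by
  refine IsLeast.csInf_eq ⟨⟨0, ?_⟩, ?_⟩
  · simp [hα.le, div_nonneg]
  · rintro _ ⟨k, rfl⟩
    rcases le_or_gt 0 k with hk | hk
    · have hk' : (0 : ℝ) ≤ k := by exact_mod_cast hk
      refine le_trans ?_ (le_abs_self _)
      nlinarith [mul_nonneg hk' hα.le]
    · have hk' : (k : ℝ) ≤ -1 := by exact_mod_cast (by omega : k ≤ -1)
      refine le_trans ?_ (neg_le_abs _)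
      nlinarith

theorem abs_sub_le_coneDist (α : ℝ) {p q : ℝ × ℝ} (hp : 0 ≤ p.1) (hq : 0 ≤ q.1) :
    |p.1 - q.1| ≤ coneDist α p q := by
  refine Real.abs_le_sqrt ?_
  nlinarith [mul_le_mul_of_nonneg_left (Real.cos_le_one (angDist α p.2 q.2)) (mul_nonneg hp hq)]

/-- A ball avoiding the tip that meets the ray opposite to its center has its center at
distance at most `πρ/α` from the tip. -/
theorem mul_le_pi_mul_of_coneDist_opposite_le {α : ℝ} (hα : α ∈ Set.Ioo 0 (2 * π))
    {p : ℝ × ℝ} (hp : 0 < p.1) {ρ t : ℝ} (hρ : 0 < ρ) (hρp : ρ < p.1) (ht : 0 < t)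
    (h : coneDist α (t, p.2 + α / 2) p ≤ ρ) : α * p.1 ≤ π * ρ := by
  obtain ⟨hα0, hα2⟩ := hα
  have hsq : t ^ 2 + p.1 ^ 2 - 2 * t * p.1 * Real.cos (α / 2) ≤ ρ ^ 2 := by
    have h' := (Real.sqrt_le_left hρ.le).1 h
    rwa [angDist_add_half hα0] at h'
  have hcos : 0 < Real.cos (α / 2) := by
    by_contra! hc
    nlinarith [mul_nonneg (mul_pos ht hp).le (neg_nonneg.2 hc), sq_nonneg t]
  have hαπ : α / 2 ≤ π / 2 := by
    by_contra! hc
    exact absurd (Real.cos_nonpos_of_pi_div_two_le_of_le hc.le (by linarith)) (not_le.2 hcos)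
  have hsin : p.1 * Real.sin (α / 2) ≤ ρ := by
    refine le_of_abs_le (abs_le_of_sq_le_sq ?_ hρ.le)
    nlinarith [sq_nonneg (t - p.1 * Real.cos (α / 2)), Real.sin_sq_add_cos_sq (α / 2)]
  have hjordan : α ≤ π * Real.sin (α / 2) := by
    have := mul_le_mul_of_nonneg_left (Real.mul_le_sin (by positivity) hαπ) Real.pi_pos.le
    field_simp at this
    linarith
  calc α * p.1 ≤ π * Real.sin (α / 2) * p.1 := by gcongr
    _ = π * (p.1 * Real.sin (α / 2)) := by ring
    _ ≤ π * ρ := by gcongr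

/-- A closed ball on the punctured cone which does not contain the tip but intersects
every ray from the tip lies within radial distance `(1 + 2π/α)ρ` of the tip. -/
theorem stmt_8 (α : ℝ) (hα : α ∈ Set.Ioo 0 (2 * π)) (p : ℝ × ℝ) (hp : 0 < p.1)
    (ρ : ℝ) (hρ : 0 < ρ) (hρp : ρ < p.1)
    (hself : ∀ θ₀ : ℝ, ∃ t : ℝ, 0 < t ∧ coneDist α (t, θ₀) p ≤ ρ) :
    ∀ r θ : ℝ, 0 < r → coneDist α (r, θ) p ≤ ρ → r ≤ (1 + 2 * π / α) * ρ := by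
  intro r θ hr h
  obtain ⟨t, ht, hd⟩ := hself (p.2 + α / 2)
  have hcenter : p.1 ≤ π * ρ / α := by
    rw [le_div_iff₀ hα.1, mul_comm]
    exact mul_le_pi_mul_of_coneDist_opposite_le hα hp hρ hρp ht hd
  have hr' : r - p.1 ≤ ρ :=
    (le_abs_self _).trans ((abs_sub_le_coneDist α (p := (r, θ)) hr.le hp.le).trans h)
  have hpos : 0 < π * ρ / α := div_pos (by positivity) hα.1
  calc r ≤ ρ + 2 * (π * ρ / α) := by linarith
    _ = (1 + 2 * π / α) * ρ := by ring
end
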